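/- arXiv:2108.01168 — 2 statements merged into one kernel-verified Lean document; each statement's English description precedes it below -/
import Mathlib

section
/- Let D be an H-colored quasi-transitive digraph and k ≥ 4. If u, v are vertices of D such that there exists a uv-walk in D, then either u and v are adjacent in D, or (v,u) is a symmetric arc in the (k−1,H)-closure C_H^{k−1}(D) (i.e., both (u,v) and (v,u) are arcs of C_H^{k−1}(D)). -/
/-!
Setting: `A : V → V → Prop` is the arc relation of a loopless digraph `D`,
`AH : VH → VH → Prop` is the arc relation of a digraph `H` (possibly with loops),
and `ρ : V → V → VH` colors each arc of `D` with a vertex of `H`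
(`D` is an `H`-colored digraph).
-/

open scoped Classical

noncomputable section

variable {V VH : Type*}

/-- `x 0, x 1, …, x n` is a walk of length `n` in the digraph with arc relation `A`. -/
def IsWalk (A : V → V → Prop) (n : ℕ) (x : ℕ → V) : Prop :=
  ∀ i < n, A (x i) (x (i + 1))

/-- A (directed) path of length `n`: a walk whose `n + 1` vertices are pairwise distinct. -/
def IsPath (A : V → V → Prop) (n : ℕ) (x : ℕ → V) : Prop :=
  IsWalk A n x ∧ ∀ i ≤ n, ∀ j ≤ n, x i = x j → i = j

/-- A (directed) cycle of length `n`: a nontrivial closed walk whose first `n` vertices are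
pairwise distinct. -/
def IsCycle (A : V → V → Prop) (n : ℕ) (x : ℕ → V) : Prop :=
  IsWalk A n x ∧ x n = x 0 ∧ 1 ≤ n ∧ ∀ i < n, ∀ j < n, x i = x j → i = j

/-- The set `O_H(W)` of obstructions of an open walk `W = (x 0, …, x n)`: the indices
`i ∈ {1, …, n-1}` such that `(ρ(x_{i-1}, x_i), ρ(x_i, x_{i+1}))` is not an arc of `H`. -/
def obstrOpen (AH : VH → VH → Prop) (ρ : V → V → VH) (n : ℕ) (x : ℕ → V) : Finset ℕ :=
  (Finset.Ico 1 n).filter fun i => ¬ AH (ρ (x (i - 1)) (x i)) (ρ (x i) (x (i + 1)))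

/-- The set `O_H(W)` of obstructions of a closed walk `W = (x 0, …, x n)` (`x n = x 0`):
the indices `i ∈ {0, …, n-1}`, taken modulo `n`, such that
`(ρ(x_{i-1}, x_i), ρ(x_i, x_{i+1}))` is not an arc of `H`. -/
def obstrClosed (AH : VH → VH → Prop) (ρ : V → V → VH) (n : ℕ) (x : ℕ → V) : Finset ℕ :=
  (Finset.range n).filter fun i =>
    ¬ AH (ρ (x (if i = 0 then n - 1 else i - 1)) (x i)) (ρ (x i) (x (i + 1)))

/-- The `H`-length of an open walk: `|O_H(W)| + 1`. -/
def HLenOpen (AH : VH → VH → Prop) (ρ : V → V → VH) (n : ℕ) (x : ℕ → V) : ℕ :=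
  (obstrOpen AH ρ n x).card + 1

/-- The `H`-length of a closed walk: `|O_H(W)|`. -/
def HLenClosed (AH : VH → VH → Prop) (ρ : V → V → VH) (n : ℕ) (x : ℕ → V) : ℕ :=
  (obstrClosed AH ρ n x).card

/-- `(u,v)` is an arc of the `(l,H)`-closure `C_H^l(D)` iff there exists a `uv`-path in `D`
with `H`-length at most `l`. -/
def ClosureAdj (A : V → V → Prop) (AH : VH → VH → Prop) (ρ : V → V → VH) (l : ℕ)
    (u v : V) : Prop :=
  ∃ n x, 1 ≤ n ∧ IsPath A n x ∧ x 0 = u ∧ x n = v ∧ HLenOpen AH ρ n x ≤ l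

/-- `S` is `(k,H)`-independent: every path between two different vertices of `S`
has `H`-length at least `k`. -/
def KHIndependent (A : V → V → Prop) (AH : VH → VH → Prop) (ρ : V → V → VH)
    (k : ℕ) (S : Set V) : Prop :=
  ∀ u ∈ S, ∀ v ∈ S, u ≠ v →
    ∀ n x, IsPath A n x → x 0 = u → x n = v → k ≤ HLenOpen AH ρ n x

/-- `S` is `(l,H)`-absorbent: from every vertex outside `S` there exists a path to some
vertex of `S` with `H`-length at most `l`. -/
def LHAbsorbent (A : V → V → Prop) (AH : VH → VH → Prop) (ρ : V → V → VH)
    (l : ℕ) (S : Set V) : Prop :=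
  ∀ v ∉ S, ∃ w ∈ S, ∃ n x, IsPath A n x ∧ x 0 = v ∧ x n = w ∧ HLenOpen AH ρ n x ≤ l

/-- A `(k,H)`-kernel: a `(k,H)`-independent and `(k-1,H)`-absorbent set of vertices. -/
def IsKHKernel (A : V → V → Prop) (AH : VH → VH → Prop) (ρ : V → V → VH)
    (k : ℕ) (S : Set V) : Prop :=
  KHIndependent A AH ρ k S ∧ LHAbsorbent A AH ρ (k - 1) S

/-- A kernel of a digraph: an independent and absorbent set of vertices. -/
def IsKernel (A : V → V → Prop) (S : Set V) : Prop :=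
  (∀ u ∈ S, ∀ v ∈ S, u ≠ v → ¬ A u v) ∧ ∀ u ∉ S, ∃ v ∈ S, A u v

/-- A digraph is quasi-transitive if the endpoints of every path of length `2` are
joined by an arc. -/
def QuasiTransitive (A : V → V → Prop) : Prop :=
  ∀ x : ℕ → V, IsPath A 2 x → A (x 0) (x 2) ∨ A (x 2) (x 0)

/-- Two distinct vertices joined by a path of length two are adjacent in a quasi-transitive
digraph. -/
lemma QuasiTransitive.adj_of_adj_of_adj {A : V → V → Prop} (hloopless : ∀ v : V, ¬ A v v)
    (hqt : QuasiTransitive A) {a b c : V} (hab : A a b) (hbc : A b c) (hac : a ≠ c) :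
    A a c ∨ A c a := by
  have hne : a ≠ b := fun h => hloopless b (h ▸ hab)
  have hne' : b ≠ c := fun h => hloopless c (h ▸ hbc)
  refine hqt (fun t => if t = 0 then a else if t = 1 then b else c) ⟨?_, ?_⟩
  · intro i hi
    interval_cases i <;> simpa
  · intro i hi j hj
    interval_cases i <;> interval_cases j <;> simp [hne, hne', hac, hne.symm, hne'.symm, hac.symm]

/-- The vertices at positions `i + 1, …, i + c` of a walk can be skipped along an arc. -/
lemma IsWalk.skip {A : V → V → Prop} {n : ℕ} {x : ℕ → V} (hx : IsWalk A n x) {i c : ℕ}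
    (hic : i + c < n) (h : A (x i) (x (i + 1 + c))) :
    IsWalk A (n - c) (fun t => if t ≤ i then x t else x (t + c)) := by
  intro t ht
  rcases lt_trichotomy t i with hti | rfl | hti
  · simpa [hti.le, Nat.succ_le_of_lt hti] using hx t (by omega)
  · simpa using h
  · simpa [show ¬ t ≤ i by omega, show ¬ t + 1 ≤ i by omega, add_right_comm]
      using hx (t + c) (by omega)

section Shortest

variable {A : V → V → Prop} {n : ℕ} {x : ℕ → V} (hx : IsWalk A n x)
  (hmin : ∀ m y, IsWalk A m y → y 0 = x 0 → y m = x n → n ≤ m)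

include hx hmin

/-- A shortest walk has no forward chords. -/
lemma IsWalk.not_adj_of_shortest {i j : ℕ} (hij : i + 2 ≤ j) (hj : j ≤ n) :
    ¬ A (x i) (x j) := by
  intro h
  obtain ⟨c, rfl⟩ : ∃ c, j = i + 1 + c := ⟨j - i - 1, by omega⟩
  have := hmin _ _ (hx.skip (by omega) h) (by simp)
    (by simp [show ¬ n - c ≤ i by omega, show n - c + c = n by omega])
  omega

/-- A shortest walk does not repeat vertices. -/
lemma IsWalk.ne_of_shortest {i j : ℕ} (hij : i < j) (hj : j ≤ n) : x i ≠ x j := by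
  intro h
  rcases hj.eq_or_lt with rfl | hjn
  · exact absurd (hmin i x (fun t ht => hx t (by omega)) rfl h) (by omega)
  · exact hx.not_adj_of_shortest hmin (j := j + 1) (by omega) hjn (h ▸ hx j hjn)

/-- A shortest walk is a path. -/
lemma IsWalk.isPath_of_shortest : IsPath A n x := by
  refine ⟨hx, fun i hi j hj h => ?_⟩
  rcases lt_trichotomy i j with hij | hij | hij
  · exact absurd h (hx.ne_of_shortest hmin hij hj)
  · exact hij
  · exact absurd h.symm (hx.ne_of_shortest hmin hij hi)

/-- Along a shortest walk of a quasi-transitive digraph, all backward arcs are present between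
vertices at distance `2` or at least `4`. -/
lemma IsWalk.adj_back_of_shortest (hloopless : ∀ v : V, ¬ A v v) (hqt : QuasiTransitive A)
    (d : ℕ) (hd : d = 2 ∨ 4 ≤ d) : ∀ i, i + d ≤ n → A (x (i + d)) (x i) := by
  induction d using Nat.strong_induction_on with
  | _ d ih =>
    intro i hi
    have adj_of_path {i j m : ℕ} (hij : i + 2 ≤ j) (hj : j ≤ n)
        (h : A (x i) (x m) ∧ A (x m) (x j) ∨ A (x j) (x m) ∧ A (x m) (x i)) :
        A (x j) (x i) := by
      have hne : x i ≠ x j := hx.ne_of_shortest hmin (by omega) hj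
      have hnot := hx.not_adj_of_shortest hmin hij hj
      rcases h with ⟨h₁, h₂⟩ | ⟨h₁, h₂⟩
      · exact (hqt.adj_of_adj_of_adj hloopless h₁ h₂ hne).resolve_left hnot
      · exact (hqt.adj_of_adj_of_adj hloopless h₁ h₂ hne.symm).resolve_right hnot
    have two {i : ℕ} (hi : i + 2 ≤ n) : A (x (i + 2)) (x i) :=
      adj_of_path le_rfl hi (.inl ⟨hx i (by omega), hx (i + 1) (by omega)⟩)
    rcases hd with rfl | hd
    · exact two hi
    · refine adj_of_path (by omega) hi (.inr ⟨?_, two (by omega)⟩)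
      rcases hd.eq_or_lt with rfl | hd
      · exact two (i := i + 2) hi
      · have h := ih (d - 1) (by omega) (by omega) (i + 1) (by omega)
        rw [show i + 1 + (d - 1) = i + d by omega] at h
        exact adj_of_path (by omega) hi (.inr ⟨h, hx (i + 1) (by omega)⟩)

end Shortest

/-- The `H`-length of a nontrivial open walk is at most its length. -/
lemma HLenOpen_le (AH : VH → VH → Prop) (ρ : V → V → VH) {n : ℕ} (hn : 1 ≤ n) (x : ℕ → V) :
    HLenOpen AH ρ n x ≤ n := by
  have h : (obstrOpen AH ρ n x).card ≤ (Finset.Ico 1 n).card := Finset.card_filter_le _ _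
  rw [Nat.card_Ico] at h
  unfold HLenOpen
  omega

/-- In an `H`-colored quasi-transitive digraph, if there exists a `uv`-walk then either
`u` and `v` are adjacent in `D`, or `(v,u)` is a symmetric arc of the `(k-1,H)`-closure
(`k ≥ 4`). -/
theorem quasiTransitive_adj_or_symm_closure
    (A : V → V → Prop) (hloopless : ∀ v : V, ¬ A v v)
    (hqt : QuasiTransitive A)
    (AH : VH → VH → Prop) (ρ : V → V → VH)
    (k : ℕ) (hk : 4 ≤ k)
    (u v : V) (huv : u ≠ v)
    (hwalk : ∃ n x, IsWalk A n x ∧ x 0 = u ∧ x n = v) :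
    (A u v ∨ A v u) ∨
      (ClosureAdj A AH ρ (k - 1) v u ∧ ClosureAdj A AH ρ (k - 1) u v) := by
  obtain ⟨n, ⟨x, hx, rfl, rfl⟩, hmin'⟩ :
      ∃ n, (∃ x, IsWalk A n x ∧ x 0 = u ∧ x n = v) ∧
        ∀ m, (∃ x, IsWalk A m x ∧ x 0 = u ∧ x m = v) → n ≤ m :=
    ⟨Nat.find hwalk, Nat.find_spec hwalk, fun m => Nat.find_min' hwalk⟩
  have hmin : ∀ m y, IsWalk A m y → y 0 = x 0 → y m = x n → n ≤ m :=
    fun m y hy h0 hm => hmin' m ⟨y, hy, h0, hm⟩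
  have hpos : n ≠ 0 := by
    rintro rfl
    exact huv rfl
  rcases (by omega : n = 1 ∨ n = 3 ∨ (n = 2 ∨ 4 ≤ n)) with rfl | rfl | h
  · exact .inl (.inl (hx 0 one_pos))
  · have hp := hx.isPath_of_shortest hmin
    have h20 := hx.adj_back_of_shortest hmin hloopless hqt 2 (.inl rfl) 0 (by omega)
    have h31 := hx.adj_back_of_shortest hmin hloopless hqt 2 (.inl rfl) 1 (by omega)
    have h12 := hx 1 (by omega)
    refine .inr ⟨⟨3, fun t => x (if t = 0 then 3 else if t = 3 then 0 else t), by omega,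
      ⟨?_, ?_⟩, rfl, rfl, (HLenOpen_le AH ρ (by omega) _).trans (by omega)⟩,
      ⟨3, x, by omega, hp, rfl, rfl, (HLenOpen_le AH ρ (by omega) x).trans (by omega)⟩⟩
    · intro i hi
      interval_cases i
      · exact h31
      · exact h12
      · exact h20
    · intro i hi j hj h
      have := hp.2 _ (by split_ifs <;> omega) _ (by split_ifs <;> omega) h
      split_ifs at this <;> omega
  · exact .inl (.inr (by simpa using hx.adj_back_of_shortest hmin hloopless hqt n h 0 (by omega)))
end
end

section
/- Let D be an H-colored local in-tournament. If every cycle in D has H-length at most k−2 (where k ≥ 2), then D has a (k,H)-kernel. -/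
/-!
Setting: `A : V → V → Prop` is the arc relation of a loopless digraph `D`,
`AH : VH → VH → Prop` is the arc relation of a digraph `H` (possibly with loops),
and `ρ : V → V → VH` colors each arc of `D` with a vertex of `H`
(`D` is an `H`-colored digraph).
-/

open scoped Classical

noncomputable section

variable {V VH : Type*}

/-- A local in-tournament: the in-neighborhood of every vertex induces a tournament. -/
def LocalInTournament (A : V → V → Prop) : Prop :=
  ∀ x u v : V, A u x → A v x → u ≠ v → (A u v ↔ ¬ A v u)

open Relation

/-- A walk all of whose vertices satisfy `P` can be shortened to a path with the same ends. -/
lemma exists_nodup_chain {A : V → V → Prop} {P : V → Prop} {a b : V}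
    (h : ReflTransGen (fun x y => A x y ∧ P y) a b) (ha : P a) :
    ∃ l : List V, (a :: l).Nodup ∧ (a :: l).IsChain A ∧ (a :: l).getLast? = some b ∧
      ∀ x ∈ a :: l, P x := by
  induction h using ReflTransGen.head_induction_on with
  | refl => exact ⟨[], by simp, by simp, by simp, by simpa using ha⟩
  | @head a c hac _ ih =>
    obtain ⟨l, hn, hc, hl, hP⟩ := ih hac.2
    by_cases hmem : a ∈ c :: l
    · obtain ⟨s, t, hst⟩ := List.append_of_mem hmem
      rw [hst] at hn hc hl hP
      refine ⟨t, (List.nodup_append.1 hn).2.1, hc.right_of_append, ?_, ?_⟩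
      · simpa [List.getLast?_append] using hl
      · intro x hx
        exact hP x (List.mem_append_right s hx)
    · refine ⟨c :: l, List.nodup_cons.2 ⟨hmem, hn⟩, List.isChain_cons_cons.2 ⟨hac.1, hc⟩, ?_, ?_⟩
      · simpa [List.getLast?_cons_cons] using hl
      · intro x hx
        rcases List.mem_cons.1 hx with rfl | hx
        · exact ha
        · exact hP x hx

/-- A walk ending in `P` but not starting in `P` enters `P` for good at some arc. -/
lemma exists_last_entry {A : V → V → Prop} {P : V → Prop} {a b : V}
    (h : ReflTransGen A a b) (ha : ¬ P a) (hb : P b) :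
    ∃ c d, ¬ P c ∧ P d ∧ A c d ∧ ReflTransGen (fun x y => A x y ∧ P y) d b := by
  induction h with
  | refl => exact absurd hb ha
  | @tail c d _ hcd ih =>
    by_cases hc : P c
    · obtain ⟨e, f, he, hf, hef, hfc⟩ := ih hc
      exact ⟨e, f, he, hf, hef, hfc.tail ⟨hcd, hb⟩⟩
    · exact ⟨c, d, hc, hb, hcd, .refl⟩

/-- A walk starting in `P` but not ending in `P` leaves `P` at some arc. -/
lemma exists_exit {A : V → V → Prop} {P : V → Prop} {a b : V}
    (h : ReflTransGen A a b) (ha : P a) (hb : ¬ P b) :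
    ∃ c d, P c ∧ ¬ P d ∧ A c d ∧ ReflTransGen A a c := by
  induction h with
  | refl => exact absurd ha hb
  | @tail c d hac hcd ih =>
    by_cases hc : P c
    · exact ⟨c, d, hc, hb, hcd, hac⟩
    · exact ih hc

/-- Replacing an arc of a cycle by a path avoiding the cycle gives a cycle. -/
lemma chain_insert {A : V → V → Prop} {p c : V} {q ws : List V}
    (hn : (p :: q).Nodup) (hc : Cycle.Chain A (p :: q : List V))
    (hh : (q ++ [p]).head? = some c) (hws : ws.Nodup) (hdisj : ∀ x ∈ ws, x ∉ p :: q)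
    (hch : (p :: ws ++ [c]).IsChain A) :
    (p :: (ws ++ q)).Nodup ∧ Cycle.Chain A (p :: (ws ++ q) : List V) := by
  constructor
  · simp only [List.mem_cons, not_or] at hdisj
    simp only [List.nodup_cons, List.nodup_append, List.mem_append] at hn ⊢
    grind
  · rw [Cycle.chain_coe_cons] at hc ⊢
    obtain ⟨t, ht⟩ : ∃ t, q ++ [p] = c :: t := by
      cases hq : q ++ [p] with
      | nil => simp at hq
      | cons d t => rw [hq] at hh; simp at hh; exact ⟨t, by rw [hh]⟩
    rw [List.append_assoc, ht]
    rw [ht] at hc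
    have := List.IsChain.append_overlap (l₁ := p :: ws) (l₂ := [c]) (l₃ := t) hch
      (List.isChain_cons_cons.1 hc).2 (by simp)
    simpa using this

/-- A vertex outside a cycle of maximum length dominating one vertex of it dominates all. -/
lemma dominates_of_maximal {A : V → V → Prop} (hlit : LocalInTournament A) {s : Cycle V}
    (hn : s.Nodup) (hs : s.Chain A) {u : V} (hu : u ∈ s)
    (hmax : ∀ s' : Cycle V, s'.Nodup → s'.Chain A → u ∈ s' → s'.length ≤ s.length)
    {w : V} (hw : w ∉ s) (q : List V) :
    ∀ (c : V) (r : List V), ((c :: r ++ q : List V) : Cycle V) = s → (∀ x ∈ c :: r, A w x) →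
      ∀ x ∈ c :: r ++ q, A w x := by
  induction q using List.reverseRecOn with
  | nil => intro c r _ h; simpa using h
  | append_singleton q p ih =>
    intro c r hrs h
    have hrot : ((p :: (c :: r ++ q) : List V) : Cycle V) = s := by
      rw [← hrs, Cycle.coe_cons_eq_coe_append]; simp
    have hpc : A p c := by
      rw [← hrot, Cycle.chain_coe_cons] at hs
      exact (List.isChain_cons_cons.1 hs).1
    have hwp : A w p := by
      by_contra hwp
      have hne : p ≠ w := by
        rintro rfl
        exact hw (hrot ▸ by simp)
      have hpw : A p w := (hlit c p w hpc (h c (by simp)) hne).2 hwp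
      subst hrot
      obtain ⟨h1, h2⟩ := chain_insert (ws := [w]) (c := c) hn hs (by simp) (by simp)
        (by simpa using hw) (by simpa using ⟨hpw, h c (by simp)⟩)
      have := hmax (p :: ([w] ++ (c :: r ++ q)) : List V) h1 h2 (by
        simp only [Cycle.mem_coe_iff, List.mem_cons, List.mem_append] at hu ⊢
        tauto)
      simp at this
    have := ih p (c :: r) (by simpa using hrot) (by
      intro x hx
      rcases List.mem_cons.1 hx with rfl | hx
      · exact hwp
      · exact h x hx)
    intro x hx
    apply this
    simp only [List.mem_cons, List.mem_append, List.not_mem_nil] at hx ⊢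
    tauto

lemma exists_cons_eq_of_mem {s : Cycle V} {a : V} (h : a ∈ s) :
    ∃ l : List V, ((a :: l : List V) : Cycle V) = s := by
  induction s using Quotient.inductionOn with
  | h l =>
    obtain ⟨t, r, rfl⟩ := List.append_of_mem (show a ∈ l from h)
    exact ⟨r ++ t, Cycle.coe_eq_coe.2 (by simpa using List.isRotated_append (l := a :: r) (l' := t))⟩

/-- In a finite local in-tournament, two mutually reachable vertices lie on a common cycle. -/
lemma exists_common_cycle [Fintype V] {A : V → V → Prop} (hlit : LocalInTournament A)
    {u v : V} (huv : u ≠ v) (h1 : ReflTransGen A u v) (h2 : ReflTransGen A v u) :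
    ∃ s : Cycle V, s.Nodup ∧ s.Chain A ∧ u ∈ s ∧ v ∈ s := by
  let Q : ℕ → Prop := fun n => ∃ s : Cycle V, s.Nodup ∧ s.Chain A ∧ u ∈ s ∧ s.length = n
  have hbound : ∀ n, Q n → n ≤ Fintype.card V := by
    rintro n ⟨s, hs, -, -, rfl⟩
    induction s using Quotient.inductionOn with
    | h l => exact List.Nodup.length_le_card (show l.Nodup from hs)
  have hex : ∃ n, Q n := by
    obtain rfl | ⟨a, hua, hav⟩ := h1.cases_head
    · exact absurd rfl huv
    have hau : ReflTransGen (fun x y => A x y ∧ True) a u := by simpa using hav.trans h2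
    obtain ⟨l, hn, hc, hl, -⟩ := exists_nodup_chain hau trivial
    refine ⟨_, (a :: l : List V), hn, ?_, ?_, rfl⟩
    · rw [Cycle.chain_coe_cons, ← List.cons_append, List.isChain_append]
      refine ⟨hc, by simp, ?_⟩
      intro x hx y hy
      rw [hl] at hx
      simp at hx hy
      rwa [← hx, ← hy]
    · exact List.mem_of_getLast? hl
  obtain ⟨n, hn⟩ := hex
  obtain ⟨s, hsn, hsc, hus, hlen⟩ := Nat.findGreatest_spec (P := Q) (hbound n hn) hn
  have hmax : ∀ s' : Cycle V, s'.Nodup → s'.Chain A → u ∈ s' → s'.length ≤ s.length := by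
    intro s' a b c
    rw [hlen]
    exact Nat.le_findGreatest (hbound _ ⟨s', a, b, c, rfl⟩) ⟨s', a, b, c, rfl⟩
  refine ⟨s, hsn, hsc, hus, ?_⟩
  by_contra hvs
  obtain ⟨w, c, hw, hc, hwc, hvw⟩ := exists_exit (P := fun x => x ∉ s) h2 hvs (by simpa)
  obtain ⟨l, rfl⟩ := exists_cons_eq_of_mem (not_not.1 hc)
  have hdom := dominates_of_maximal hlit hsn hsc hus hmax hw l c [] rfl (by simpa using hwc)
  obtain ⟨p, d, hp, hd, hpd, hdw⟩ := exists_last_entry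
    (P := fun x => x ∉ ((c :: l : List V) : Cycle V)) (h1.trans hvw) (not_not.2 hus) hw
  obtain ⟨t, hn, hch, hl, hP⟩ := exists_nodup_chain hdw hd
  obtain ⟨q, hq⟩ := exists_cons_eq_of_mem (not_not.1 hp)
  have hmem : ∀ x, x ∈ p :: q ↔ x ∈ c :: l := by
    intro x
    rw [← Cycle.mem_coe_iff, hq, Cycle.mem_coe_iff]
  rw [← hq] at hsn hsc hus hmax hP
  obtain ⟨e, he⟩ : ∃ e, (q ++ [p]).head? = some e := by cases q <;> simp
  have hwe : A w e := by
    apply hdom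
    have : e ∈ p :: q := by
      have := List.mem_of_head? he
      simp at this ⊢
      tauto
    simpa using (hmem e).1 this
  obtain ⟨g1, g2⟩ := chain_insert (ws := d :: t) hsn hsc he hn hP (by
    rw [List.isChain_append]
    refine ⟨List.isChain_cons_cons.2 ⟨hpd, hch⟩, by simp, ?_⟩
    intro x hx y hy
    rw [List.getLast?_cons_cons, hl] at hx
    simp at hx hy
    rwa [← hx, ← hy])
  have := hmax (p :: (d :: t ++ q) : List V) g1 g2 (by
    simp only [Cycle.mem_coe_iff, List.mem_cons, List.mem_append] at hus ⊢
    tauto)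
  simp at this

/-- Mutually reachable vertices are joined by a path of small `H`-length when all cycles have small
`H`-length. -/
lemma exists_path_of_mutually_reachable [Fintype V] {A : V → V → Prop}
    (hlit : LocalInTournament A) (AH : VH → VH → Prop) (ρ : V → V → VH) {k : ℕ} (hk : 2 ≤ k)
    (hcyc : ∀ (n : ℕ) (y : ℕ → V), IsCycle A n y → HLenClosed AH ρ n y ≤ k - 2)
    {u v : V} (h1 : ReflTransGen A u v) (h2 : ReflTransGen A v u) :
    ∃ n x, IsPath A n x ∧ x 0 = u ∧ x n = v ∧ HLenOpen AH ρ n x ≤ k - 1 := by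
  by_cases huv : u = v
  · subst huv
    refine ⟨0, fun _ => u, ⟨by simp [IsWalk], by simp⟩, rfl, rfl, ?_⟩
    simp [HLenOpen, obstrOpen]
    omega
  obtain ⟨s, hn, hs, hu, hv⟩ := exists_common_cycle hlit huv h1 h2
  obtain ⟨l, rfl⟩ := exists_cons_eq_of_mem hu
  have hn : (u :: l).Nodup := hn
  rw [Cycle.chain_coe_cons, List.isChain_iff_getElem] at hs
  let y : ℕ → V := fun i => (u :: (l ++ [u])).getD i u
  have hy : ∀ i (hi : i < (u :: l).length), y i = (u :: l)[i] := by
    intro i hi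
    simp only [y, ← List.cons_append]
    rw [List.getD_append _ _ _ _ hi, List.getD_eq_getElem _ _ hi]
  have hinj : ∀ i < (u :: l).length, ∀ j < (u :: l).length, y i = y j → i = j := by
    intro i hi j hj h
    rw [hy i hi, hy j hj] at h
    exact (hn.getElem_inj_iff).1 h
  have hwalk : IsWalk A (u :: l).length y := by
    intro i hi
    have := hs i (by simpa using hi)
    simp only [y]
    rwa [List.getD_eq_getElem _ _ (by simp at hi ⊢; omega),
      List.getD_eq_getElem _ _ (by simpa using hi)]
  have hcycle : IsCycle A (u :: l).length y := ⟨hwalk, by simp [y], by simp, hinj⟩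
  obtain ⟨m, hm, hmv⟩ := List.getElem_of_mem (show v ∈ u :: l from hv)
  refine ⟨m, y, ⟨fun i hi => hwalk i (hi.trans hm), fun i hi j hj => hinj i (by omega) j (by omega)⟩,
    rfl, by rw [hy m hm, hmv], ?_⟩
  have hle := hcyc _ _ hcycle
  have hsub : obstrOpen AH ρ m y ⊆ obstrClosed AH ρ (u :: l).length y := by
    intro i hi
    simp only [obstrOpen, obstrClosed, Finset.mem_filter, Finset.mem_Ico, Finset.mem_range] at hi ⊢
    refine ⟨by omega, ?_⟩
    rw [if_neg (by omega)]
    exact hi.2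
  have := Finset.card_le_card hsub
  simp only [HLenOpen, HLenClosed] at *
  omega

lemma IsWalk.reflTransGen {A : V → V → Prop} {n : ℕ} {x : ℕ → V} (h : IsWalk A n x) :
    ReflTransGen A (x 0) (x n) := by
  induction n with
  | zero => exact .refl
  | succ n ih => exact (ih fun i hi => h i (by omega)).tail (h n (by omega))

/-- A relation `R` contained in a preorder `T` and containing the symmetric part of `T` has
a kernel in every finite set. -/
lemma exists_kernel_of_preorder {R T : V → V → Prop} (hrefl : ∀ a, T a a)
    (htrans : ∀ a b c, T a b → T b c → T a c) (hRT : ∀ a b, R a b → T a b)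
    (hTR : ∀ a b, T a b → T b a → R a b) (s : Finset V) :
    ∃ S ⊆ s, (∀ u ∈ S, ∀ v ∈ S, u ≠ v → ¬ R u v) ∧ ∀ v ∈ s, v ∉ S → ∃ w ∈ S, R v w := by
  induction s using Finset.strongInduction with
  | H s ih =>
    obtain rfl | hs := s.eq_empty_or_nonempty
    · exact ⟨∅, by simp⟩
    obtain ⟨m, hms, hm⟩ : ∃ m ∈ s, ∀ x ∈ s, T m x → T x m := by
      let _ : Preorder V := { le := T, le_refl := hrefl, le_trans := htrans }
      obtain ⟨m, hm⟩ := s.exists_maximal hs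
      exact ⟨m, hm.1, fun x hx h => hm.2 hx h⟩
    obtain ⟨S, hSs, hind, habs⟩ := ih (s.filter fun x => ¬ R x m)
      (Finset.filter_ssubset.2 ⟨m, hms, by simpa using hTR m m (hrefl m) (hrefl m)⟩)
    have hS : ∀ x ∈ S, x ∈ s ∧ ¬ R x m := fun x hx => Finset.mem_filter.1 (hSs hx)
    have hmS : ∀ x ∈ S, ¬ R m x := fun x hx h =>
      (hS x hx).2 (hTR x m (hm x (hS x hx).1 (hRT m x h)) (hRT m x h))
    refine ⟨insert m S, Finset.insert_subset hms fun x hx => (hS x hx).1, ?_, ?_⟩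
    · intro u hu v hv huv
      rcases Finset.mem_insert.1 hu with rfl | huS <;> rcases Finset.mem_insert.1 hv with rfl | hvS
      · exact absurd rfl huv
      · exact hmS v hvS
      · exact (hS u huS).2
      · exact hind u huS v hvS huv
    · intro v hv hvS
      rw [Finset.mem_insert, not_or] at hvS
      by_cases hvm : R v m
      · exact ⟨m, by simp, hvm⟩
      · obtain ⟨w, hw, hvw⟩ := habs v (Finset.mem_filter.2 ⟨hv, hvm⟩) hvS.2
        exact ⟨w, Finset.mem_insert_of_mem hw, hvw⟩

/-- Every `H`-colored local in-tournament in which every cycle has `H`-length at most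
`k - 2` (`k ≥ 2`) has a `(k,H)`-kernel. -/
theorem localInTournament_has_kHKernel [Fintype V]
    (A : V → V → Prop) (hloopless : ∀ v : V, ¬ A v v)
    (hlit : LocalInTournament A)
    (AH : VH → VH → Prop) (ρ : V → V → VH)
    (k : ℕ) (hk : 2 ≤ k)
    (hcyc : ∀ (n : ℕ) (y : ℕ → V), IsCycle A n y → HLenClosed AH ρ n y ≤ k - 2) :
    ∃ S : Set V, IsKHKernel A AH ρ k S := by
  obtain ⟨S, -, hind, habs⟩ := exists_kernel_of_preorder
    (R := fun u v => ∃ n x, IsPath A n x ∧ x 0 = u ∧ x n = v ∧ HLenOpen AH ρ n x ≤ k - 1)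
    (T := ReflTransGen A) (fun _ => .refl) (fun _ _ _ => .trans)
    (by rintro _ _ ⟨n, x, hx, rfl, rfl, -⟩; exact hx.1.reflTransGen)
    (fun _ _ => exists_path_of_mutually_reachable hlit AH ρ hk hcyc) Finset.univ
  refine ⟨S, ?_, fun v hv => habs v (Finset.mem_univ v) hv⟩
  intro u hu v hv huv n x hx hx0 hxn
  by_contra hlt
  exact hind u hu v hv huv ⟨n, x, hx, hx0, hxn, by omega⟩
end
end
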